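/- Let A be an associative unital (possibly noncommutative) ℚ-algebra, let n ≥ 2, and let A[t₁,…,tₙ] be the polynomial ring over A in n central, pairwise commuting variables. Let γ₁ = Σ_{i=0}^{d₁} m_i·t₁^i and γ₂ = Σ_{i=0}^{d₂} m'_i·t₂^i, where every m_i and m'_i lies in the center Z(A) of A and the leading coefficients m_{d₁} and m'_{d₂} are nonzero rational numbers. If γ₁ divides q·γ₂ in A[t₁,…,tₙ] for some q ∈ A[t₁,…,tₙ], then γ₁ divides q. -/

import Mathlib

open Polynomial in
/-- If the top coefficient of `g` is a unit, then `g` may be cancelled on the right in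
divisibility by a constant polynomial, over any ring. -/
theorem Polynomial.C_dvd_of_C_dvd_mul {R : Type*} [Ring R] {c : R} {p g : R[X]} {d : ℕ}
    (hg : g.natDegree ≤ d) (hu : IsUnit (g.coeff d)) (h : C c ∣ p * g) : C c ∣ p := by
  have hcoeff : ∀ k, c ∣ p.coeff k := by
    intro k
    induction hj : p.natDegree + 1 - k using Nat.strong_induction_on generalizing k with
    | _ j ih =>
      subst hj
      by_cases hk : p.natDegree < k
      · simp [coeff_eq_zero_of_natDegree_lt hk]
      obtain ⟨r, hr⟩ := h
      have hsum : c ∣ (p * g).coeff (k + d) := ⟨r.coeff (k + d), by rw [hr, coeff_C_mul]⟩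
      have hmem : (k, d) ∈ Finset.HasAntidiagonal.antidiagonal (k + d) := by simp
      rw [coeff_mul, ← Finset.add_sum_erase _ _ hmem] at hsum
      have hrest : c ∣ ∑ x ∈ (Finset.HasAntidiagonal.antidiagonal (k + d)).erase (k, d),
          p.coeff x.1 * g.coeff x.2 := by
        refine Finset.dvd_sum fun ⟨a, b⟩ hab => ?_
        simp only [Finset.mem_erase, Finset.HasAntidiagonal.mem_antidiagonal, ne_eq, Prod.mk.injEq] at hab
        by_cases hb : d < b
        · simp [coeff_eq_zero_of_natDegree_lt (hg.trans_lt hb)]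
        · exact (ih _ (by omega) a rfl).mul_right _
      exact hu.dvd_mul_right.1 ((dvd_add_left hrest).1 hsum)
  rw [p.as_sum_range_C_mul_X_pow]
  refine Finset.dvd_sum fun k _ => ?_
  obtain ⟨r, hr⟩ := hcoeff k
  exact ⟨C r * X ^ k, by rw [hr, C_mul, mul_assoc]⟩

namespace AddMonoidAlgebra

open Polynomial

variable {A σ : Type*} [Ring A]

/-- A polynomial in the variables `σ` viewed as a univariate polynomial in the variable `i`,
whose coefficients do not involve `i`. -/
noncomputable def toPolynomialIn (i : σ) :
    AddMonoidAlgebra A (σ →₀ ℕ) →+* (AddMonoidAlgebra A (σ →₀ ℕ))[X] :=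
  liftNCRingHom (C.comp singleZeroRingHom)
    { toFun := fun s => C (single (s.toAdd.erase i) 1) * X ^ s.toAdd i
      map_one' := by simp [← one_def]
      map_mul' := fun s t => by
        rw [toAdd_mul, Finsupp.erase_add, Finsupp.add_apply, pow_add, ← mul_one (1 : A),
          ← single_mul_single, C_mul, mul_one, mul_assoc, mul_assoc, ← mul_assoc (X ^ _) (C _),
          X_pow_mul (p := C _), mul_assoc] }
    fun a s => by
      refine Commute.mul_right ?_ (X_pow_mul (n := _)).symm
      simp [Commute, SemiconjBy, ← C_mul, single_mul_single]

theorem toPolynomialIn_single (i : σ) (s : σ →₀ ℕ) (a : A) :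
    toPolynomialIn i (single s a) = C (single (s.erase i) a) * X ^ s i := by
  simp [toPolynomialIn, liftNCRingHom, ← mul_assoc, ← C_mul, single_mul_single]

theorem commute_single_one (s : σ →₀ ℕ) (x : AddMonoidAlgebra A (σ →₀ ℕ)) :
    Commute x (single s 1) := by
  induction x using AddMonoidAlgebra.induction_linear with
  | zero => exact Commute.zero_left _
  | add x y hx hy => exact hx.add_left hy
  | single t a => simp [Commute, SemiconjBy, single_mul_single, add_comm]

theorem eval_toPolynomialIn (i : σ) (x : AddMonoidAlgebra A (σ →₀ ℕ)) :
    eval₂RingHom' (RingHom.id _) (single (Finsupp.single i 1) 1)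
      (fun y => commute_single_one _ y) (toPolynomialIn i x) = x := by
  induction x using AddMonoidAlgebra.induction_linear with
  | zero => simp
  | add x y hx hy => rw [map_add, map_add, hx, hy]
  | single t a =>
    rw [toPolynomialIn_single, map_mul, map_pow]
    simp [eval₂RingHom', single_pow, single_mul_single, Finsupp.erase_add_single]

/-- Left divisibility descends along `toPolynomialIn i`. -/
theorem dvd_of_C_dvd_toPolynomialIn {i : σ} {x y : AddMonoidAlgebra A (σ →₀ ℕ)}
    (hx : toPolynomialIn i x = C x) (h : C x ∣ toPolynomialIn i y) : x ∣ y := by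
  have := map_dvd (eval₂RingHom' (RingHom.id _) (single (Finsupp.single i 1) 1)
      (fun y => commute_single_one _ y)) (hx ▸ h)
  rwa [eval_toPolynomialIn, eval_toPolynomialIn] at this

end AddMonoidAlgebra


/-- **The key divisibility reduction in the proof of Lemma 6.3 (lem:elem1) of the paper.**
Let `A` be an associative unital (possibly noncommutative) ℚ-algebra, `n ≥ 2`, and let
`A[t₁,…,tₙ]` be the polynomial ring over `A` in `n` central, pairwise commuting variables
(realized as `AddMonoidAlgebra A (Fin n →₀ ℕ)`).  Let `γ₁ = Σ_{i=0}^{d₁} m_i·t₁^i` and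
`γ₂ = Σ_{i=0}^{d₂} m'_i·t₂^i`, where all coefficients lie in the center of `A` and the
leading coefficients are nonzero rationals.  If `γ₁ ∣ q·γ₂` for some `q`, then `γ₁ ∣ q`. -/
theorem dvd_of_dvd_mul_poly_other_variable
    (A : Type*) [Ring A] [Algebra ℚ A] (n : ℕ) (hn : 2 ≤ n)
    (d₁ d₂ : ℕ) (m₁ m₂ : ℕ → A)
    (hm₁ : ∀ i ≤ d₁, m₁ i ∈ Set.center A)
    (hm₂ : ∀ i ≤ d₂, m₂ i ∈ Set.center A)
    (hl₁ : ∃ c : ℚ, c ≠ 0 ∧ m₁ d₁ = algebraMap ℚ A c)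
    (hl₂ : ∃ c : ℚ, c ≠ 0 ∧ m₂ d₂ = algebraMap ℚ A c)
    (t₁ t₂ : AddMonoidAlgebra A (Fin n →₀ ℕ))
    (ht₁ : t₁ = AddMonoidAlgebra.single (Finsupp.single (⟨0, by omega⟩ : Fin n) 1) 1)
    (ht₂ : t₂ = AddMonoidAlgebra.single (Finsupp.single (⟨1, by omega⟩ : Fin n) 1) 1)
    (γ₁ γ₂ : AddMonoidAlgebra A (Fin n →₀ ℕ))
    (hγ₁ : γ₁ = ∑ i ∈ Finset.range (d₁ + 1), AddMonoidAlgebra.single 0 (m₁ i) * t₁ ^ i)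
    (hγ₂ : γ₂ = ∑ i ∈ Finset.range (d₂ + 1), AddMonoidAlgebra.single 0 (m₂ i) * t₂ ^ i)
    (q : AddMonoidAlgebra A (Fin n →₀ ℕ))
    (h : γ₁ ∣ q * γ₂) : γ₁ ∣ q := by
  open Polynomial in
  subst ht₁ ht₂
  set i₂ : Fin n := ⟨1, by omega⟩
  have hγ₁C : AddMonoidAlgebra.toPolynomialIn i₂ γ₁ = C γ₁ := by
    rw [hγ₁, map_sum, map_sum]
    refine Finset.sum_congr rfl fun k _ => ?_
    rw [AddMonoidAlgebra.single_pow, AddMonoidAlgebra.single_mul_single,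
      AddMonoidAlgebra.toPolynomialIn_single]
    simp [i₂, Finsupp.erase_of_notMem_support]
  have hγ₂C : AddMonoidAlgebra.toPolynomialIn i₂ γ₂ =
      ∑ k ∈ Finset.range (d₂ + 1), C (AddMonoidAlgebra.single 0 (m₂ k)) * X ^ k := by
    rw [hγ₂, map_sum]
    refine Finset.sum_congr rfl fun k _ => ?_
    rw [AddMonoidAlgebra.single_pow, AddMonoidAlgebra.single_mul_single,
      AddMonoidAlgebra.toPolynomialIn_single]
    simp
  refine AddMonoidAlgebra.dvd_of_C_dvd_toPolynomialIn hγ₁C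
    (C_dvd_of_C_dvd_mul (g := AddMonoidAlgebra.toPolynomialIn i₂ γ₂) (d := d₂) ?_ ?_ ?_)
  · rw [hγ₂C]
    refine natDegree_sum_le_of_forall_le _ _ fun k hk => ?_
    exact (natDegree_C_mul_X_pow_le _ _).trans (Nat.lt_succ_iff.1 (Finset.mem_range.1 hk))
  · obtain ⟨c, hc, hmc⟩ := hl₂
    have hcoeff : (AddMonoidAlgebra.toPolynomialIn i₂ γ₂).coeff d₂ =
        AddMonoidAlgebra.singleZeroRingHom (algebraMap ℚ A c) := by
      rw [hγ₂C, finsetSum_coeff, Finset.sum_eq_single d₂]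
      · simp [hmc]
      · intro k _ hk
        rw [coeff_C_mul_X_pow, if_neg hk.symm]
      · simp
    rw [hcoeff]
    exact ((IsUnit.mk0 c hc).map (algebraMap ℚ A)).map _
  · have hdvd := map_dvd (AddMonoidAlgebra.toPolynomialIn i₂) h
    rwa [map_mul, hγ₁C] at hdvd
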